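/- arXiv:2309.04585 — 3 statements merged into one kernel-verified Lean document; each statement's English description precedes it below -/
import Mathlib

section
/- Let N ∈ ℕ, let F, g : ℝ^N → ℝ be convex functions, let ρ > 0, and let (X*, z*, λ*) be a saddle point of the Lagrangian L with X* = z*. Suppose sequences (X^k)_{k≥1}, (z^k)_{k≥0}, (z̃^k)_{k≥1}, (λ^k)_{k≥0} in ℝ^N satisfy the inexact-ADMM iterate conditions (i)–(iv) at every step k ≥ 0, and suppose there are constants Δ ≥ 0, n ∈ ℕ, M_λ ≥ 0, M_z ≥ 0 such that for all k ≥ 0: ‖e^{k+1}‖ ≤ 2Δ√n, ‖λ^{k+1}‖ ≤ M_λ, and ‖z* − z̃^{k+1}‖ ≤ M_z. Then for every integer k ≥ 1, setting X̄^k := (1/k) Σ_{s=0}^{k-1} X^{s+1} and z̄^k := (1/k) Σ_{s=0}^{k-1} z^{s+1}, it holds that 0 ≤ L(X̄^k, z̄^k, λ*) − L(X*, z*, λ*) ≤ (1/k)·( ‖λ* − λ^0‖²/(2ρ) + (ρ/2)‖X* − z^0‖² ) + (M_λ + ρ M_z)·2Δ√n. -/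
open scoped RealInnerProductSpace

/-- The Lagrangian `L(X, z, λ) = F(X) + g(z) + ⟪λ, X − z⟫`. -/
noncomputable def Lagrangian (N : ℕ) (F g : EuclideanSpace ℝ (Fin N) → ℝ)
    (X z lam : EuclideanSpace ℝ (Fin N)) : ℝ :=
  F X + g z + ⟪lam, X - z⟫

/-- `(X*, z*, λ*)` is a saddle point of the Lagrangian `L`. -/
def IsSaddlePoint (N : ℕ) (F g : EuclideanSpace ℝ (Fin N) → ℝ)
    (Xs zs lams : EuclideanSpace ℝ (Fin N)) : Prop :=
  ∀ X z lam : EuclideanSpace ℝ (Fin N),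
    Lagrangian N F g Xs zs lam ≤ Lagrangian N F g Xs zs lams ∧
    Lagrangian N F g Xs zs lams ≤ Lagrangian N F g X z lams

/-- The inexact-ADMM iterate conditions (i)–(iv) at a step, for the data
`(X^{k+1}, z^k, z^{k+1}, z̃^{k+1}, λ^k, λ^{k+1})`, with error
`e^{k+1} = z^{k+1} − z̃^{k+1}`:
(i) dual update `λ^{k+1} = λ^k + ρ(X^{k+1} − z^{k+1})`;
(ii) a subgradient `h^{k+1}` of `F` at `X^{k+1}` with the `x`-update optimality
condition; (iii) a subgradient `ĝ^{k+1}` of `g` at `z̃^{k+1}` with the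
`z`-update optimality condition; (iv) `g(z̃^{k+1}) = g(z^{k+1})`. -/
def InexactADMMStep (N : ℕ) (F g : EuclideanSpace ℝ (Fin N) → ℝ) (ρ : ℝ)
    (X1 z0 z1 zt1 lam0 lam1 : EuclideanSpace ℝ (Fin N)) : Prop :=
  lam1 = lam0 + ρ • (X1 - z1) ∧
  (∃ h : EuclideanSpace ℝ (Fin N),
    (∀ Y, F Y ≥ F X1 + ⟪h, Y - X1⟫) ∧
    (∀ Y, ⟪Y - X1, h + lam1 + ρ • (z1 - z0)⟫ ≥ 0)) ∧
  (∃ gh : EuclideanSpace ℝ (Fin N),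
    (∀ w, g w ≥ g zt1 + ⟪gh, w - zt1⟫) ∧
    (∀ w, ⟪w - zt1, gh - lam1 - ρ • (z1 - zt1)⟫ ≥ 0)) ∧
  g zt1 = g z1


open scoped BigOperators

lemma admm_core {E : Type*} [NormedAddCommGroup E] [InnerProductSpace ℝ E] (ρ : ℝ) (hρ : 0 < ρ)
    (a b c d : E) :
    ⟪a - ρ • d, d⟫ + ρ * ⟪b, c - b - d⟫ ≤
      (‖a‖ ^ 2 / (2 * ρ) + (ρ / 2) * ‖c‖ ^ 2) -
      (‖a - ρ • d‖ ^ 2 / (2 * ρ) + (ρ / 2) * ‖c - b‖ ^ 2) := by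
  have h := mul_nonneg hρ.le (sq_nonneg ‖b + d‖)
  have e : ‖a‖ ^ 2 / (2 * ρ) - ‖a - ρ • d‖ ^ 2 / (2 * ρ) = ⟪a, d⟫ - ρ / 2 * ‖d‖ ^ 2 := by
    rw [norm_sub_sq_real, norm_smul, inner_smul_right, Real.norm_eq_abs, mul_pow, sq_abs]
    field_simp
    ring
  rw [norm_add_sq_real] at h
  have e2 := norm_sub_sq_real c b
  simp only [inner_sub_left, inner_sub_right, inner_smul_left, real_inner_self_eq_norm_sq,
    real_inner_comm b c, RCLike.conj_to_real] at *
  rw [e2]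
  nlinarith

lemma admm_step (N : ℕ) (F g : EuclideanSpace ℝ (Fin N) → ℝ) (ρ : ℝ) (hρ : 0 < ρ)
    (zs lams X1 z0 z1 zt1 lam0 lam1 : EuclideanSpace ℝ (Fin N))
    (h : InexactADMMStep N F g ρ X1 z0 z1 zt1 lam0 lam1) (B Mlam Mz : ℝ)
    (hMlam : 0 ≤ Mlam) (hMz : 0 ≤ Mz)
    (herr : ‖z1 - zt1‖ ≤ B) (hlam : ‖lam1‖ ≤ Mlam) (hzt : ‖zs - zt1‖ ≤ Mz) :
    Lagrangian N F g X1 z1 lams - Lagrangian N F g zs zs lams ≤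
      (‖lams - lam0‖ ^ 2 / (2 * ρ) + (ρ / 2) * ‖zs - z0‖ ^ 2) -
      (‖lams - lam1‖ ^ 2 / (2 * ρ) + (ρ / 2) * ‖zs - z1‖ ^ 2) + (Mlam + ρ * Mz) * B := by
  obtain ⟨h1, ⟨p, hp, hp'⟩, ⟨q, hq, hq'⟩, h4⟩ := h
  have c := admm_core ρ hρ (lams - lam0) (z1 - z0) (zs - z0) (X1 - z1)
  have e1 : lams - lam0 - ρ • (X1 - z1) = lams - lam1 := by rw [h1]; abel
  have e2 : zs - z0 - (z1 - z0) = zs - z1 := by abel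
  have e3 : zs - z1 - (X1 - z1) = zs - X1 := by abel
  rw [e1, e2, e3] at c
  have i1 : -⟪lam1, z1 - zt1⟫ ≤ Mlam * B :=
    (neg_le_abs _).trans ((abs_real_inner_le_norm _ _).trans
      (mul_le_mul hlam herr (norm_nonneg _) hMlam))
  have i2 : -⟪zs - zt1, z1 - zt1⟫ ≤ Mz * B :=
    (neg_le_abs _).trans ((abs_real_inner_le_norm _ _).trans
      (mul_le_mul hzt herr (norm_nonneg _) hMz))
  have i3 := mul_le_mul_of_nonneg_left i2 hρ.le
  have a1 := hp zs
  have a2 := hp' zs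
  have a3 := hq zs
  have a4 := hq' zs
  have key : Lagrangian N F g X1 z1 lams - Lagrangian N F g zs zs lams ≤
      ⟪lams - lam1, X1 - z1⟫ + ρ * ⟪z1 - z0, zs - X1⟫ - ⟪lam1, z1 - zt1⟫
        + ρ * -⟪zs - zt1, z1 - zt1⟫ := by
    unfold Lagrangian
    rw [sub_self, inner_zero_right]
    rw [inner_sub_right, inner_sub_right, inner_smul_right, real_inner_comm] at a4
    rw [inner_add_right, inner_add_right, inner_smul_right, real_inner_comm] at a2
    rw [real_inner_comm (zs - X1) (z1 - z0)] at *
    have f : ⟪lams - lam1, X1 - z1⟫ = ⟪lams, X1 - z1⟫ - ⟪lam1, X1 - z1⟫ := inner_sub_left _ _ _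
    have f2 : ⟪lam1, X1 - z1⟫ + ⟪lam1, z1 - zt1⟫ = ⟪zs - zt1, lam1⟫ - ⟪zs - X1, lam1⟫ := by
      rw [← inner_add_right, ← inner_sub_left, real_inner_comm]
      congr 1
      abel
    linarith
  linarith

lemma jensen_avg {E : Type*} [AddCommGroup E] [Module ℝ E] (f : E → ℝ)
    (hf : ConvexOn ℝ Set.univ f) (x : ℕ → E) (k : ℕ) (hk : 1 ≤ k) :
    f ((1 / (k : ℝ)) • ∑ s ∈ Finset.range k, x s) ≤
      (1 / (k : ℝ)) * ∑ s ∈ Finset.range k, f (x s) := by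
  have hk' : (k : ℝ) ≠ 0 := by positivity
  have := hf.map_sum_le (t := Finset.range k) (w := fun _ => 1 / (k : ℝ)) (p := x)
    (fun _ _ => by positivity) (by simp [hk']) (fun _ _ => Set.mem_univ _)
  simpa only [smul_eq_mul, ← Finset.smul_sum, ← Finset.mul_sum] using this

/-- Ergodic `O(1/k)` convergence of the quantized asynchronous ADMM
(Theorem 1): if `(X*, z*, λ*)` is a saddle point of the Lagrangian with
`X* = z*`, the sequences satisfy the inexact-ADMM iterate conditions at every
step, the consensus error satisfies `‖e^{k+1}‖ ≤ 2Δ√n`, and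
`‖λ^{k+1}‖ ≤ M_λ`, `‖z* − z̃^{k+1}‖ ≤ M_z`, then for every `k ≥ 1`, the ergodic
averages `X̄^k, z̄^k` satisfy
`0 ≤ L(X̄^k, z̄^k, λ*) − L(X*, z*, λ*) ≤
  (1/k)(‖λ* − λ⁰‖²/(2ρ) + (ρ/2)‖X* − z⁰‖²) + (M_λ + ρM_z)·2Δ√n`. -/
theorem quantized_admm_ergodic_convergence (N : ℕ)
    (F g : EuclideanSpace ℝ (Fin N) → ℝ)
    (hF : ConvexOn ℝ Set.univ F) (hg : ConvexOn ℝ Set.univ g)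
    (ρ : ℝ) (hρ : 0 < ρ)
    (Xs zs lams : EuclideanSpace ℝ (Fin N))
    (hsaddle : IsSaddlePoint N F g Xs zs lams) (hXz : Xs = zs)
    (X z zt lam : ℕ → EuclideanSpace ℝ (Fin N))
    (hstep : ∀ k : ℕ,
      InexactADMMStep N F g ρ (X (k + 1)) (z k) (z (k + 1)) (zt (k + 1))
        (lam k) (lam (k + 1)))
    (Δ : ℝ) (hΔ : 0 ≤ Δ) (n : ℕ) (Mlam Mz : ℝ)
    (hMlam : 0 ≤ Mlam) (hMz : 0 ≤ Mz)
    (herr : ∀ k : ℕ, ‖z (k + 1) - zt (k + 1)‖ ≤ 2 * Δ * Real.sqrt n)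
    (hlam : ∀ k : ℕ, ‖lam (k + 1)‖ ≤ Mlam)
    (hzt : ∀ k : ℕ, ‖zs - zt (k + 1)‖ ≤ Mz) :
    ∀ k : ℕ, 1 ≤ k →
      0 ≤ Lagrangian N F g
            ((1 / (k : ℝ)) • ∑ s ∈ Finset.range k, X (s + 1))
            ((1 / (k : ℝ)) • ∑ s ∈ Finset.range k, z (s + 1)) lams -
          Lagrangian N F g Xs zs lams ∧
      Lagrangian N F g
            ((1 / (k : ℝ)) • ∑ s ∈ Finset.range k, X (s + 1))
            ((1 / (k : ℝ)) • ∑ s ∈ Finset.range k, z (s + 1)) lams -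
          Lagrangian N F g Xs zs lams ≤
        (1 / (k : ℝ)) * (‖lams - lam 0‖ ^ 2 / (2 * ρ) +
          (ρ / 2) * ‖Xs - z 0‖ ^ 2) +
        (Mlam + ρ * Mz) * (2 * Δ * Real.sqrt n) := by
  subst hXz
  intro k hk
  refine ⟨sub_nonneg.2 (hsaddle _ _ lams).2, ?_⟩
  have hk' : (0 : ℝ) < k := by positivity
  set B := 2 * Δ * Real.sqrt n
  have hs : ∀ m : ℕ, ∑ s ∈ Finset.range m,
      (Lagrangian N F g (X (s + 1)) (z (s + 1)) lams - Lagrangian N F g Xs Xs lams) ≤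
      (‖lams - lam 0‖ ^ 2 / (2 * ρ) + (ρ / 2) * ‖Xs - z 0‖ ^ 2) -
      (‖lams - lam m‖ ^ 2 / (2 * ρ) + (ρ / 2) * ‖Xs - z m‖ ^ 2)
        + m * ((Mlam + ρ * Mz) * B) := by
    intro m
    induction m with
    | zero => simp
    | succ m ih =>
      have := admm_step N F g ρ hρ Xs lams _ _ _ _ _ _ (hstep m) B Mlam Mz hMlam hMz
        (herr m) (hlam m) (hzt m)
      rw [Finset.sum_range_succ]
      push_cast
      linarith
  have hs1 := hs k
  have hnn : 0 ≤ ‖lams - lam k‖ ^ 2 / (2 * ρ) + (ρ / 2) * ‖Xs - z k‖ ^ 2 := by positivity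
  rw [Finset.sum_sub_distrib, Finset.sum_const, Finset.card_range, nsmul_eq_mul] at hs1
  have hJ : Lagrangian N F g
      ((1 / (k : ℝ)) • ∑ s ∈ Finset.range k, X (s + 1))
      ((1 / (k : ℝ)) • ∑ s ∈ Finset.range k, z (s + 1)) lams ≤
      (1 / (k : ℝ)) * ∑ s ∈ Finset.range k, Lagrangian N F g (X (s + 1)) (z (s + 1)) lams := by
    unfold Lagrangian
    rw [← smul_sub, ← Finset.sum_sub_distrib, inner_smul_right, inner_sum,
      Finset.sum_add_distrib, Finset.sum_add_distrib, mul_add, mul_add]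
    have j1 := jensen_avg F hF (fun s => X (s + 1)) k hk
    have j2 := jensen_avg g hg (fun s => z (s + 1)) k hk
    linarith
  set S := ∑ s ∈ Finset.range k, Lagrangian N F g (X (s + 1)) (z (s + 1)) lams
  set C := ‖lams - lam 0‖ ^ 2 / (2 * ρ) + (ρ / 2) * ‖Xs - z 0‖ ^ 2
  have h3 : S ≤ C + k * ((Mlam + ρ * Mz) * B + Lagrangian N F g Xs Xs lams) := by linarith
  have h4 := mul_le_mul_of_nonneg_left h3 (one_div_pos.2 hk').le
  rw [mul_add, ← mul_assoc, one_div_mul_cancel hk'.ne', one_mul] at h4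
  linarith
end

section
/- Let N ∈ ℕ, let F, g : ℝ^N → ℝ be convex, let ρ > 0, and let (X*, z*, λ*) be a saddle point of the Lagrangian L with X* = z*. Suppose the data (X^{k+1}, z^k, z^{k+1}, z̃^{k+1}, λ^k, λ^{k+1}) with error e^{k+1} := z^{k+1} − z̃^{k+1} satisfies the inexact-ADMM iterate conditions (i)–(iv) at step k. Then F(X^{k+1}) − F(X*) + g(z^{k+1}) − g(z*) + ⟪λ*, X^{k+1} − z^{k+1}⟫ ≤ (1/ρ)⟪λ* − λ^{k+1}, λ^{k+1} − λ^k⟫ + ρ⟪X* − X^{k+1}, z^{k+1} − z^k⟫ − ⟪λ^{k+1} + ρ(z* − z̃^{k+1}), e^{k+1}⟫. -/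
open scoped RealInnerProductSpace

/-- Intermediate per-iteration inequality in the convergence proof of the
quantized asynchronous ADMM (combining subgradient inequalities with the dual
update). -/
theorem admm_intermediate_inequality (N : ℕ)
    (F g : EuclideanSpace ℝ (Fin N) → ℝ)
    (hF : ConvexOn ℝ Set.univ F) (hg : ConvexOn ℝ Set.univ g)
    (ρ : ℝ) (hρ : 0 < ρ)
    (Xs zs lams : EuclideanSpace ℝ (Fin N))
    (hsaddle : IsSaddlePoint N F g Xs zs lams) (hXz : Xs = zs)
    (X1 z0 z1 zt1 lam0 lam1 : EuclideanSpace ℝ (Fin N))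
    (hstep : InexactADMMStep N F g ρ X1 z0 z1 zt1 lam0 lam1) :
    F X1 - F Xs + g z1 - g zs + ⟪lams, X1 - z1⟫ ≤
      (1 / ρ) * ⟪lams - lam1, lam1 - lam0⟫ +
      ρ * ⟪Xs - X1, z1 - z0⟫ -
      ⟪lam1 + ρ • (zs - zt1), z1 - zt1⟫ := by
  obtain ⟨hl, ⟨h, hh1, hh2⟩, ⟨gh, hg1, hg2⟩, he⟩ := hstep
  subst hXz
  have a1 := hh1 Xs
  have a2 := hh2 Xs
  have a3 := hg1 Xs
  have a4 := hg2 Xs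
  have hd : lam1 - lam0 = ρ • (X1 - z1) := by rw [hl]; abel
  have e1 : (1 / ρ) * ⟪lams - lam1, lam1 - lam0⟫ = ⟪lams - lam1, X1 - z1⟫ := by
    rw [hd, inner_smul_right]
    field_simp
  rw [e1]
  rw [real_inner_comm] at a2 a4
  simp only [inner_add_left, inner_sub_left, inner_add_right, inner_sub_right,
    real_inner_smul_left, real_inner_smul_right] at *
  rw [real_inner_comm Xs z1, real_inner_comm Xs z0, real_inner_comm X1 z1,
    real_inner_comm X1 z0] at *
  rw [real_inner_comm zt1 z1] at *
  rw [real_inner_comm Xs zt1] at a4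
  linarith
end

section
/- Let N ∈ ℕ, let F, g : ℝ^N → ℝ be convex, let ρ > 0, and let (X*, z*, λ*) be a saddle point of the Lagrangian L with X* = z*. Suppose the data (X^{k+1}, z^k, z^{k+1}, z̃^{k+1}, λ^k, λ^{k+1}) with error e^{k+1} := z^{k+1} − z̃^{k+1} satisfies the inexact-ADMM iterate conditions (i)–(iv) at step k. Then F(X^{k+1}) − F(X*) + g(z^{k+1}) − g(z*) + ⟪λ*, X^{k+1} − z^{k+1}⟫ ≤ (1/(2ρ))(‖λ* − λ^k‖² − ‖λ* − λ^{k+1}‖²) + (ρ/2)(‖X* − z^k‖² − ‖X* − z^{k+1}‖²) − ⟪λ^{k+1} + ρ(z* − z̃^{k+1}), e^{k+1}⟫. -/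
open scoped RealInnerProductSpace

/-- Key per-iteration telescoping (contraction) inequality in the convergence
proof of the quantized asynchronous ADMM. -/
theorem admm_contraction_inequality (N : ℕ)
    (F g : EuclideanSpace ℝ (Fin N) → ℝ)
    (hF : ConvexOn ℝ Set.univ F) (hg : ConvexOn ℝ Set.univ g)
    (ρ : ℝ) (hρ : 0 < ρ)
    (Xs zs lams : EuclideanSpace ℝ (Fin N))
    (hsaddle : IsSaddlePoint N F g Xs zs lams) (hXz : Xs = zs)
    (X1 z0 z1 zt1 lam0 lam1 : EuclideanSpace ℝ (Fin N))
    (hstep : InexactADMMStep N F g ρ X1 z0 z1 zt1 lam0 lam1) :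
    F X1 - F Xs + g z1 - g zs + ⟪lams, X1 - z1⟫ ≤
      (1 / (2 * ρ)) * (‖lams - lam0‖ ^ 2 - ‖lams - lam1‖ ^ 2) +
      (ρ / 2) * (‖Xs - z0‖ ^ 2 - ‖Xs - z1‖ ^ 2) -
      ⟪lam1 + ρ • (zs - zt1), z1 - zt1⟫ := by
  subst hXz
  obtain ⟨hl, ⟨h, hh1, hh2⟩, ⟨gh, hg1, hg2⟩, hgz⟩ := hstep
  have a1 := hh1 Xs
  have a2 := hh2 Xs
  have b1 := hg1 Xs
  have b2 := hg2 Xs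
  have e1 : (1 / (2 * ρ)) * (‖lams - lam0‖ ^ 2 - ‖lams - lam1‖ ^ 2)
      = ⟪lams - lam1, X1 - z1⟫ + ρ / 2 * ‖X1 - z1‖ ^ 2 := by
    have : lams - lam0 = (lams - lam1) + ρ • (X1 - z1) := by rw [hl]; abel
    rw [this, norm_add_sq_real, inner_smul_right, norm_smul, mul_pow, Real.norm_eq_abs, sq_abs]
    field_simp
    ring
  have e2 : 0 ≤ ρ / 2 * ‖(X1 - z1) + (z1 - z0)‖ ^ 2 := by positivity
  rw [e1]
  clear e1 hl
  have c : ∀ x y : EuclideanSpace ℝ (Fin N), ⟪x, y⟫ = ⟪y, x⟫ := fun x y => real_inner_comm _ _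
  simp only [← real_inner_self_eq_norm_sq, inner_add_left, inner_add_right, inner_sub_left,
    inner_sub_right, inner_smul_left, inner_smul_right, RCLike.conj_to_real] at *
  rw [c Xs h, c X1 h, c Xs lam1, c X1 lam1, c Xs z1, c Xs z0, c X1 z1, c X1 z0] at a2
  rw [c Xs gh, c zt1 gh, c Xs lam1, c zt1 lam1, c Xs z1, c Xs zt1, c zt1 z1] at b2
  rw [c X1 z1, c X1 z0, c z1 z0] at e2
  rw [c Xs z1, c Xs z0, c Xs zt1, c X1 z1, c zt1 z1]
  linarith
end
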